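/- arXiv:0804.3037 — 4 statements merged into one kernel-verified Lean document; each statement's English description precedes it below -/
import Mathlib

section
/- Let (Ω, ℱ, P) be a probability space, 𝒢 ⊆ ℱ a sub-σ-algebra, Y and S real random variables measurable with respect to 𝒢, ε > 0, and G a real random variable, independent of 𝒢, with the centered Gaussian law of variance ε. Then for every ξ ∈ ℝ, almost surely, |E[exp(iξ(Y + S·G)) | 𝒢]| = exp(−ε S² ξ²/2). -/
open MeasureTheory ProbabilityTheory

/-- If `X` and `Z` are independent, conditioning `f (X, Z)` on `X` amounts to integrating out `Z`
against its law. -/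
theorem condExp_prod_ae_eq_integral_map_of_indepFun {Ω β γ F : Type*} [MeasurableSpace Ω]
    [mβ : MeasurableSpace β] [MeasurableSpace γ] [StandardBorelSpace γ] [Nonempty γ]
    [NormedAddCommGroup F] [NormedSpace ℝ F] [CompleteSpace F]
    {P : Measure Ω} [IsProbabilityMeasure P] {X : Ω → β} {Z : Ω → γ} {f : β × γ → F}
    (hX : Measurable X) (hZ : Measurable Z) (hXZ : IndepFun X Z P) (hf : StronglyMeasurable f)
    (hf_int : Integrable (fun ω => f (X ω, Z ω)) P) :
    P[fun ω => f (X ω, Z ω) | mβ.comap X] =ᵐ[P] fun ω => ∫ z, f (X ω, z) ∂(P.map Z) := by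
  have : IsProbabilityMeasure (P.map Z) := Measure.isProbabilityMeasure_map hZ.aemeasurable
  have hlaw : condDistrib Z X P =ᵐ[P.map X] Kernel.const β (P.map Z) := by
    refine condDistrib_ae_eq_of_measure_eq_compProd X hZ.aemeasurable ?_
    rw [Measure.compProd_const]
    exact (indepFun_iff_map_prod_eq_prod_map_map hX.aemeasurable hZ.aemeasurable).1 hXZ
  filter_upwards [condExp_prod_ae_eq_integral_condDistrib hX hZ.aemeasurable hf hf_int,
    ae_of_ae_map hX.aemeasurable hlaw] with ω h₁ h₂
  rw [h₁, h₂, Kernel.const_apply]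

theorem norm_integral_exp_affine_gaussianReal (v : NNReal) (ξ y s : ℝ) :
    ‖∫ z, Complex.exp (Complex.I * ξ * (y + s * z)) ∂(gaussianReal 0 v)‖
      = Real.exp (-(v * s ^ 2 * ξ ^ 2) / 2) := by
  have hsplit (z : ℝ) : Complex.exp (Complex.I * ξ * (y + s * z))
      = Complex.exp ((ξ * y : ℝ) * Complex.I) *
        Complex.exp ((ξ * s : ℝ) * z * Complex.I) := by
    rw [← Complex.exp_add]
    push_cast
    ring_nf
  simp_rw [hsplit]
  rw [integral_const_mul, ← charFun_apply_real, charFun_gaussianReal, norm_mul,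
    Complex.norm_exp_ofReal_mul_I, one_mul, Complex.norm_exp]
  congr 1
  have hexp : ((ξ * s : ℝ) : ℂ) * (0 : ℝ) * Complex.I - (v : ℂ) * ((ξ * s : ℝ) : ℂ) ^ 2 / 2
      = ((-(v * s ^ 2 * ξ ^ 2) / 2 : ℝ) : ℂ) := by
    push_cast
    ring
  rw [hexp, Complex.ofReal_re]

theorem norm_condExp_exp_affine_gaussian_comap {Ω β : Type*} [MeasurableSpace Ω]
    [mβ : MeasurableSpace β] {P : Measure Ω} [IsProbabilityMeasure P] {X : Ω → β} {G : Ω → ℝ}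
    {v : NNReal} {y s : β → ℝ} (hX : Measurable X) (hG : Measurable G)
    (hGlaw : P.map G = gaussianReal 0 v) (hXG : IndepFun X G P)
    (hy : Measurable y) (hs : Measurable s) (ξ : ℝ) :
    ∀ᵐ ω ∂P, ‖(P[fun ω' => Complex.exp (Complex.I * ξ * (y (X ω') + s (X ω') * G ω')) |
        mβ.comap X]) ω‖ = Real.exp (-(v * s (X ω) ^ 2 * ξ ^ 2) / 2) := by
  have hf : Measurable fun p : β × ℝ => Complex.exp (Complex.I * ξ * (y p.1 + s p.1 * p.2)) := by
    fun_prop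
  have hint : Integrable
      (fun ω => Complex.exp (Complex.I * ξ * (y (X ω) + s (X ω) * G ω))) P := by
    refine Integrable.of_bound (hf.comp (hX.prodMk hG)).aestronglyMeasurable 1 (ae_of_all _ ?_)
    intro ω
    simp [Complex.norm_exp]
  filter_upwards [condExp_prod_ae_eq_integral_map_of_indepFun hX hG hXG hf.stronglyMeasurable hint]
    with ω hω
  rw [hω, hGlaw, norm_integral_exp_affine_gaussianReal]

/-- Let `𝒢` be a sub-σ-algebra, `Y` and `S` real random variables measurable with respect
to `𝒢`, `ε > 0`, and `G` a real random variable which is independent of `𝒢` and has the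
centered Gaussian law of variance `ε`. Then for every `ξ ∈ ℝ`, almost surely,
`|E[exp(iξ(Y + S·G)) | 𝒢]| = exp(-ε S² ξ²/2)`. -/
theorem norm_condexp_charFun_gaussian_step
    {Ω : Type*} [mΩ : MeasurableSpace Ω] (P : Measure Ω) [IsProbabilityMeasure P]
    (ε : ℝ) (hε : 0 < ε)
    (G : Ω → ℝ) (hG : Measurable G)
    (hGlaw : Measure.map G P = gaussianReal 0 ⟨ε, hε.le⟩)
    (𝒢 : MeasurableSpace Ω) (h𝒢 : 𝒢 ≤ mΩ)
    (Y S : Ω → ℝ) (hY : Measurable[𝒢] Y) (hS : Measurable[𝒢] S)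
    (hGindep : Indep (MeasurableSpace.comap G inferInstance) 𝒢 P) :
    ∀ ξ : ℝ, ∀ᵐ ω ∂P,
      ‖(P[fun ω' => Complex.exp (Complex.I * ξ * (Y ω' + S ω' * G ω')) | 𝒢]) ω‖
        = Real.exp (-(ε * S ω ^ 2 * ξ ^ 2) / 2) := by
  intro ξ
  have hXG : @IndepFun Ω Ω ℝ mΩ 𝒢 _ id G P := by
    rw [IndepFun_iff_Indep, MeasurableSpace.comap_id]
    exact hGindep.symm
  have h := @norm_condExp_exp_affine_gaussian_comap Ω Ω mΩ 𝒢 P _ id G ⟨ε, hε.le⟩ Y S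
    (measurable_id'' h𝒢) hG hGlaw hXG hY hS ξ
  rw [MeasurableSpace.comap_id] at h
  exact h
end

section
/- Let μ be a finite nonnegative Borel measure on ℝ with Fourier transform μ̂. Suppose there exist constants C > 0, δ > 0 and θ ∈ (1/2, 1] such that for every ξ with |ξ| ≥ 1 and every ε ∈ (0,1): |μ̂(ξ)| ≤ exp(−ε δ² ξ²/2) + C|ξ| ε^{(1+θ)/2} + C ε^{θ/2}. Then ∫_ℝ |μ̂(ξ)|² dξ < ∞, and consequently μ is absolutely continuous with respect to Lebesgue measure. -/
open MeasureTheory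

/-- The Fourier transform of a finite nonnegative Borel measure on `ℝ`:
`μ̂(ξ) = ∫ e^{iξx} μ(dx)`. -/
noncomputable def fourierOfMeasure (μ : Measure ℝ) (ξ : ℝ) : ℂ :=
  ∫ x, Complex.exp (Complex.I * ξ * x) ∂μ

open Filter Topology Asymptotics FourierTransform
open scoped SchwartzMap ENNReal

section AbsolutelyContinuous

variable {V : Type*} [NormedAddCommGroup V] [InnerProductSpace ℝ V] [FiniteDimensional ℝ V]
  [MeasurableSpace V] [BorelSpace V] {μ : Measure V} [IsFiniteMeasure μ]

theorem integral_fourier_eq_integral_charFun_mul {f : V → ℂ} (hf : Integrable f) :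
    ∫ x, 𝓕 f x ∂μ = ∫ ξ, charFun μ (-(2 * Real.pi) • ξ) * f ξ := by
  have key := VectorFourier.integral_fourierIntegral_smul_eq_flip (μ := μ) (ν := volume)
    (L := innerₗ V) (f := 1) (g := f) Real.continuous_fourierChar continuous_inner
    (integrable_const 1) hf
  simp only [flip_innerₗ, Pi.one_apply, one_smul] at key
  refine key.symm.trans (integral_congr_ae (.of_forall fun ξ ↦ ?_))
  simp only [charFun_eq_fourierIntegral', smul_smul, smul_eq_mul]
  rw [neg_mul_neg, inv_mul_cancel₀ (by positivity), one_smul]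

theorem enorm_integral_fourier_le {f : V → ℂ} (hf : Integrable f) :
    ‖∫ x, 𝓕 f x ∂μ‖ₑ ≤
      eLpNorm (fun ξ ↦ charFun μ (-(2 * Real.pi) • ξ)) 2 volume * eLpNorm f 2 volume := by
  have hχ : AEStronglyMeasurable (fun ξ : V ↦ charFun μ (-(2 * Real.pi) • ξ)) volume :=
    (measurable_charFun.comp (measurable_const_smul _)).aestronglyMeasurable
  rw [integral_fourier_eq_integral_charFun_mul hf]
  refine (enorm_integral_le_lintegral_enorm _).trans ?_
  rw [← eLpNorm_one_eq_lintegral_enorm]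
  have key := eLpNorm_smul_le_mul_eLpNorm (p := 2) (q := 2) (r := 1) hf.aestronglyMeasurable hχ
  simp only [smul_eq_mul] at key
  exact key

theorem eLpNorm_fourier_schwartzMap (f : 𝓢(V, ℂ)) :
    eLpNorm (𝓕 f : 𝓢(V, ℂ)) 2 volume = eLpNorm f 2 volume := by
  have hf := SchwartzMap.norm_fourier_toL2_eq f
  rw [SchwartzMap.norm_toLp, SchwartzMap.norm_toLp] at hf
  exact (ENNReal.toReal_eq_toReal_iff' ((𝓕 f).memLp 2 volume).eLpNorm_ne_top
    (f.memLp 2 volume).eLpNorm_ne_top).1 hf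

theorem enorm_integral_schwartzMap_le (f : 𝓢(V, ℂ)) :
    ‖∫ x, f x ∂μ‖ₑ ≤
      eLpNorm (fun ξ ↦ charFun μ (-(2 * Real.pi) • ξ)) 2 volume * eLpNorm f 2 volume := by
  obtain ⟨g, rfl⟩ : ∃ g : 𝓢(V, ℂ), 𝓕 g = f := ⟨𝓕⁻ f, fourier_fourierInv_eq f⟩
  rw [eLpNorm_fourier_schwartzMap, SchwartzMap.fourier_coe]
  exact enorm_integral_fourier_le g.integrable

theorem measure_le_of_isCompact_subset_isOpen {K U : Set V} (hK : IsCompact K) (hU : IsOpen U)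
    (hKU : K ⊆ U) :
    μ K ≤ eLpNorm (fun ξ ↦ charFun μ (-(2 * Real.pi) • ξ)) 2 volume
      * volume U ^ (1 / 2 : ℝ) := by
  obtain ⟨r, hr⟩ := hK.isBounded.subset_ball 0
  obtain ⟨g, g_smooth, g_range, g_supp, hg⟩ :=
    exists_contMDiff_support_eq_eq_one_iff (modelWithCornersSelf ℝ V)
      (n := ⊤) (hU.inter Metric.isOpen_ball) hK.isClosed
      (Set.subset_inter hKU hr)
  have g_mem (x : V) : g x ∈ Set.Icc (0 : ℝ) 1 := g_range ⟨x, rfl⟩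
  have g_cpt : HasCompactSupport g := by
    refine HasCompactSupport.of_support_subset_isCompact (isCompact_closedBall 0 r) ?_
    rw [g_supp]
    exact Set.inter_subset_right.trans Metric.ball_subset_closedBall
  let f : 𝓢(V, ℂ) := (g_cpt.comp_left Complex.ofReal_zero).toSchwartzMap
    (Complex.ofRealCLM.contDiff.comp g_smooth.contDiff)
  have f_apply (x : V) : f x = (g x : ℂ) := rfl
  have hμK : μ K ≤ ‖∫ x, f x ∂μ‖ₑ := by
    have g_int : Integrable g μ := g_smooth.contDiff.continuous.integrable_of_hasCompactSupport g_cpt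
    simp only [f_apply]
    rw [integral_complex_ofReal, ← ofReal_norm, Complex.norm_real, Real.norm_of_nonneg
      (integral_nonneg fun x ↦ (g_mem x).1), ofReal_integral_eq_lintegral_ofReal g_int
      (.of_forall fun x ↦ (g_mem x).1), ← lintegral_indicator_one hK.measurableSet]
    refine lintegral_mono (Set.indicator_le fun x hx ↦ ?_)
    simp [(hg x).1 hx]
  have hf : eLpNorm f 2 volume ≤ volume U ^ (1 / 2 : ℝ) := by
    have := eLpNorm_indicator_const (μ := volume) (c := (1 : ℝ)) (p := 2) hU.measurableSet
      (by simp) (by simp)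
    simp only [enorm_one, one_mul, ENNReal.toReal_ofNat] at this
    rw [← this]
    refine eLpNorm_mono_real fun x ↦ ?_
    rw [f_apply, Complex.norm_real, Real.norm_of_nonneg (g_mem x).1]
    by_cases hx : x ∈ U
    · simpa [hx] using (g_mem x).2
    · have : g x = 0 := by
        rw [← Function.notMem_support, g_supp]
        exact fun h ↦ hx h.1
      simp [hx, this]
  exact hμK.trans ((enorm_integral_schwartzMap_le f).trans (by gcongr))

/-- A finite measure whose characteristic function is square integrable is absolutely
continuous with respect to Lebesgue measure. -/
theorem absolutelyContinuous_of_integrable_sq_charFun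
    (h : Integrable fun ξ ↦ ‖charFun μ ξ‖ ^ 2) : μ ≪ volume := by
  have hM : eLpNorm (fun ξ ↦ charFun μ (-(2 * Real.pi) • ξ)) 2 volume ≠ ∞ :=
    ((memLp_two_iff_integrable_sq_norm
      (measurable_charFun.comp (by fun_prop)).aestronglyMeasurable).2
      (h.comp_smul (by simp [Real.pi_ne_zero]))).2.ne
  refine Measure.AbsolutelyContinuous.mk fun s hs hs0 ↦ ?_
  rw [hs.measure_eq_iSup_isCompact]
  simp only [ENNReal.iSup_eq_zero]
  intro K hKs hK
  have hlim : Tendsto (fun ε : ℝ≥0∞ ↦ eLpNorm (fun ξ ↦ charFun μ (-(2 * Real.pi) • ξ)) 2 volume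
      * ε ^ (1 / 2 : ℝ)) (𝓝[>] 0) (𝓝 0) := by
    have := ENNReal.Tendsto.const_mul (a := eLpNorm (fun ξ ↦ charFun μ (-(2 * Real.pi) • ξ)) 2
      volume) ((ENNReal.continuous_rpow_const (y := 1 / 2)).tendsto 0) (Or.inr hM)
    rw [ENNReal.zero_rpow_of_pos (by norm_num), mul_zero] at this
    exact this.mono_left nhdsWithin_le_nhds
  refine le_antisymm (ge_of_tendsto hlim ?_) zero_le
  filter_upwards [self_mem_nhdsWithin] with ε hε
  obtain ⟨U, hKU, hU, hUε⟩ := hK.exists_isOpen_lt_of_lt (μ := volume) ε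
    ((measure_mono_null hKs hs0).trans_lt hε)
  exact (measure_le_of_isCompact_subset_isOpen hK hU hKU).trans (by gcongr)

end AbsolutelyContinuous

theorem fourierOfMeasure_eq_charFun (μ : Measure ℝ) : fourierOfMeasure μ = charFun μ := by
  ext ξ
  rw [charFun_apply_real, fourierOfMeasure]
  congr with x
  ring_nf

theorem exp_neg_mul_rpow_isBigO_rpow {b p : ℝ} (hb : 0 < b) (hp : 0 < p) (a : ℝ) :
    (fun t : ℝ ↦ Real.exp (-b * t ^ p)) =O[atTop] fun t ↦ t ^ a := by
  refine ((isLittleO_exp_neg_mul_rpow_atTop hb (a / p)).isBigO.comp_tendsto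
    (tendsto_rpow_atTop hp)).trans_eventuallyEq ?_
  filter_upwards [eventually_ge_atTop 0] with t ht
  rw [Function.comp_apply, ← Real.rpow_mul ht, mul_div_cancel₀ _ hp.ne']

theorem integrable_sq_of_isBigO_rpow {F : Type*} [NormedAddCommGroup F] {f : ℝ → F}
    (hf : LocallyIntegrable fun x ↦ ‖f x‖ ^ 2) {a : ℝ} (ha : 1 / 2 < a)
    (h : f =O[cocompact ℝ] fun x ↦ |x| ^ (-a)) : Integrable fun x ↦ ‖f x‖ ^ 2 := by
  have hint : Integrable fun x : ℝ ↦ (1 + ‖x‖) ^ (-(2 * a)) :=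
    integrable_one_add_norm (by simp; linarith)
  refine hf.integrable_of_isBigO_cocompact ?_ (hint.integrableAtFilter _)
  refine (h.norm_left.pow 2).trans (IsBigO.of_bound (2 ^ (2 * a)) ?_)
  filter_upwards [(tendsto_norm_cocompact_atTop (E := ℝ)).eventually_ge_atTop 1] with x hx
  rw [Real.norm_eq_abs] at hx
  have hx0 : 0 < |x| := by linarith
  rw [Real.norm_of_nonneg (by positivity), Real.norm_of_nonneg (by positivity), Real.norm_eq_abs,
    ← Real.rpow_natCast, ← Real.rpow_mul hx0.le, Real.rpow_neg (by positivity) (2 * a),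
    ← div_eq_mul_inv, ← Real.div_rpow (by norm_num) (by positivity)]
  calc |x| ^ (-a * (2 : ℕ)) = (1 / |x|) ^ (2 * a) := by
        rw [one_div, Real.inv_rpow hx0.le, ← Real.rpow_neg hx0.le]
        push_cast
        ring_nf
    _ ≤ (2 / (1 + |x|)) ^ (2 * a) := by
        refine Real.rpow_le_rpow (by positivity) ?_ (by linarith)
        rw [div_le_div_iff₀ hx0 (by positivity)]
        linarith

/-- The choice `ε = t ^ (2 * η - 2)` for a small `η > 0` in the bound
`exp (-ε δ² t² / 2) + C t ε ^ ((1 + θ) / 2) + C ε ^ (θ / 2)`. -/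
theorem bound_at_rpow_isBigO {C δ θ : ℝ} (hδ : 0 < δ) (hθ : θ ∈ Set.Ioc (1 / 2 : ℝ) 1) {η : ℝ}
    (hη : η = (θ - 1 / 2) / 4) :
    (fun t : ℝ ↦ Real.exp (-(t ^ (2 * η - 2) * δ ^ 2 * t ^ 2) / 2)
      + C * t * (t ^ (2 * η - 2)) ^ ((1 + θ) / 2) + C * (t ^ (2 * η - 2)) ^ (θ / 2))
      =O[atTop] fun t ↦ t ^ (-(θ / 2 + 1 / 4)) := by
  obtain ⟨hθ1, hθ2⟩ := hθ
  have rpow_isBigO {p q : ℝ} (hpq : p ≤ q) :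
      (fun t : ℝ ↦ t ^ p) =O[atTop] fun t ↦ t ^ q := by
    refine IsBigO.of_bound 1 ?_
    filter_upwards [eventually_ge_atTop 1] with t ht
    rw [Real.norm_of_nonneg (by positivity), Real.norm_of_nonneg (by positivity), one_mul]
    exact Real.rpow_le_rpow_of_exponent_le ht hpq
  refine IsBigO.add (IsBigO.add ?_ ?_) ?_
  · refine EventuallyEq.trans_isBigO ?_ (exp_neg_mul_rpow_isBigO_rpow (b := δ ^ 2 / 2)
      (p := 2 * η) (by positivity) (by linarith) _)
    filter_upwards [eventually_gt_atTop 0] with t ht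
    have : t ^ (2 * η - 2) * t ^ 2 = t ^ (2 * η) := by
      rw [← Real.rpow_natCast, ← Real.rpow_add ht]
      norm_num
    rw [← this]
    ring_nf
  · refine EventuallyEq.trans_isBigO ?_ ((rpow_isBigO (p := 1 + (η - 1) * (1 + θ))
      (by subst hη; nlinarith)).const_mul_left C)
    filter_upwards [eventually_gt_atTop 0] with t ht
    rw [← Real.rpow_mul ht.le, Real.rpow_add ht, Real.rpow_one]
    ring_nf
  · refine EventuallyEq.trans_isBigO ?_ ((rpow_isBigO (p := (η - 1) * θ)
      (by subst hη; nlinarith)).const_mul_left C)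
    filter_upwards [eventually_gt_atTop 0] with t ht
    rw [← Real.rpow_mul ht.le]
    ring_nf

/-- If a finite nonnegative Borel measure `μ` on `ℝ` satisfies, for some constants `C > 0`,
`δ > 0` and `θ ∈ (1/2, 1]`, the bound
`|μ̂(ξ)| ≤ exp(-ε δ² ξ²/2) + C |ξ| ε^{(1+θ)/2} + C ε^{θ/2}`
for every `|ξ| ≥ 1` and every `ε ∈ (0,1)`, then `∫ |μ̂(ξ)|² dξ < ∞` and consequently `μ`
is absolutely continuous with respect to Lebesgue measure. -/
theorem integrable_sq_fourier_and_absolutelyContinuous_brownian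
    (μ : Measure ℝ) [IsFiniteMeasure μ] (C δ θ : ℝ)
    (hC : 0 < C) (hδ : 0 < δ) (hθ : θ ∈ Set.Ioc (1 / 2 : ℝ) 1)
    (h : ∀ ξ : ℝ, 1 ≤ |ξ| → ∀ ε ∈ Set.Ioo (0 : ℝ) 1,
      ‖fourierOfMeasure μ ξ‖
        ≤ Real.exp (-(ε * δ ^ 2 * ξ ^ 2) / 2) + C * |ξ| * ε ^ ((1 + θ) / 2)
          + C * ε ^ (θ / 2)) :
    Integrable (fun ξ : ℝ => ‖fourierOfMeasure μ ξ‖ ^ 2) ∧ μ ≪ volume := by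
  have hbig : charFun μ =O[cocompact ℝ] fun ξ ↦ |ξ| ^ (-(θ / 2 + 1 / 4)) := by
    refine IsBigO.trans (IsBigO.of_bound' ?_)
      ((bound_at_rpow_isBigO (C := C) hδ hθ rfl).comp_tendsto tendsto_norm_cocompact_atTop)
    filter_upwards [(tendsto_norm_cocompact_atTop (E := ℝ)).eventually_gt_atTop 1] with ξ hξ
    rw [← fourierOfMeasure_eq_charFun]
    refine le_trans (le_trans (h ξ hξ.le (‖ξ‖ ^ (2 * ((θ - 1 / 2) / 4) - 2)) ⟨by positivity,
      Real.rpow_lt_one_of_one_lt_of_neg hξ (by linarith [hθ.2])⟩) (le_of_eq ?_)) (le_abs_self _)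
    simp only [Function.comp_apply, Real.norm_eq_abs, sq_abs]
  have hloc : LocallyIntegrable fun ξ ↦ ‖charFun μ ξ‖ ^ 2 := by
    refine (locallyIntegrable_const (μ.real Set.univ ^ 2)).mono
      (measurable_charFun.norm.pow_const 2).aestronglyMeasurable (.of_forall fun ξ ↦ ?_)
    rw [norm_pow, norm_norm, Real.norm_of_nonneg (by positivity)]
    gcongr
    exact norm_charFun_le ξ
  have hint := integrable_sq_of_isBigO_rpow hloc (by linarith [hθ.1]) hbig
  rw [fourierOfMeasure_eq_charFun]
  exact ⟨hint, absolutelyContinuous_of_integrable_sq_charFun hint⟩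
end

section
/- Let ν be a nonnegative Borel measure on ℝ∖{0}, let γ ∈ [1,2] with ∫_{ℝ∖{0}} |z|^γ ν(dz) < ∞, and suppose there exist constants c > 0, λ > 0 and ξ₀ ≥ 0 such that ∫_{ℝ∖{0}} (1 − cos(ξz)) ν(dz) ≥ c|ξ|^λ for all |ξ| ≥ ξ₀. Then λ ≤ γ. -/
open MeasureTheory

/-- For `γ ∈ [0, 2]`, the function `1 - cos` is dominated by `2 |t|^γ`. -/
theorem one_sub_cos_le_two_mul_abs_rpow {γ : ℝ} (hγ : γ ∈ Set.Icc (0 : ℝ) 2) (t : ℝ) :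
    1 - Real.cos t ≤ 2 * |t| ^ γ := by
  rcases le_total |t| 1 with h | h
  · have h2 : t ^ 2 ≤ |t| ^ γ := by
      rcases (abs_nonneg t).eq_or_lt with h0 | h0
      · have : t = 0 := abs_eq_zero.mp h0.symm
        subst this
        simpa using Real.rpow_nonneg le_rfl γ
      · rw [← sq_abs, ← Real.rpow_two]
        exact Real.rpow_le_rpow_of_exponent_ge h0 h hγ.2
    linarith [Real.one_sub_sq_div_two_le_cos (x := t), sq_nonneg t]
  · linarith [Real.neg_one_le_cos t, Real.one_le_rpow h hγ.1]

/-- For `γ ∈ [0, 2]`, the real part of the characteristic exponent of `ν` is bounded by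
`2 |ξ|^γ` times the absolute moment of `ν` of order `γ`. -/
theorem lintegral_one_sub_cos_le (ν : Measure ℝ) {γ : ℝ} (hγ : γ ∈ Set.Icc (0 : ℝ) 2) (ξ : ℝ) :
    ∫⁻ z, ENNReal.ofReal (1 - Real.cos (ξ * z)) ∂ν
      ≤ ENNReal.ofReal (2 * |ξ| ^ γ) * ∫⁻ z, ENNReal.ofReal (|z| ^ γ) ∂ν := by
  rw [← lintegral_const_mul' _ _ ENNReal.ofReal_ne_top]
  refine lintegral_mono fun z => ?_
  rw [← ENNReal.ofReal_mul (by positivity)]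
  refine ENNReal.ofReal_le_ofReal ((one_sub_cos_le_two_mul_abs_rpow hγ (ξ * z)).trans_eq ?_)
  rw [abs_mul, Real.mul_rpow (abs_nonneg _) (abs_nonneg _), mul_assoc]

/-- Let `ν` be a nonnegative Borel measure on `ℝ \ {0}` and `γ ∈ [1,2]` with
`∫ |z|^γ ν(dz) < ∞`, and suppose that for some `c > 0`, `λ > 0` and `ξ₀ ≥ 0` one has
`∫ (1 - cos(ξz)) ν(dz) ≥ c |ξ|^λ` for all `|ξ| ≥ ξ₀`. Then `λ ≤ γ`. -/
theorem levy_exponent_le_of_moment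
    (ν : Measure ℝ) (hν0 : ν {0} = 0) (γ : ℝ) (hγ : γ ∈ Set.Icc (1 : ℝ) 2)
    (hint : ∫⁻ z, ENNReal.ofReal (|z| ^ γ) ∂ν < ⊤)
    (c lam ξ₀ : ℝ) (hc : 0 < c) (hlam : 0 < lam) (hξ₀ : 0 ≤ ξ₀)
    (hlow : ∀ ξ : ℝ, ξ₀ ≤ |ξ| →
      ENNReal.ofReal (c * |ξ| ^ lam)
        ≤ ∫⁻ z, ENNReal.ofReal (1 - Real.cos (ξ * z)) ∂ν) :
    lam ≤ γ := by
  by_contra! hlt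
  obtain ⟨M, hM, hMν⟩ : ∃ M : ℝ, 0 ≤ M ∧ ∫⁻ z, ENNReal.ofReal (|z| ^ γ) ∂ν = ENNReal.ofReal M :=
    ⟨_, ENNReal.toReal_nonneg, (ENNReal.ofReal_toReal hint.ne).symm⟩
  have hbound : ∀ x : ℝ, 0 < x → ξ₀ ≤ x → x ^ (lam - γ) ≤ 2 * M / c := by
    intro x hx hxξ
    have h := (hlow x (by rwa [abs_of_pos hx])).trans
      (lintegral_one_sub_cos_le ν ⟨zero_le_one.trans hγ.1, hγ.2⟩ x)
    rw [abs_of_pos hx, hMν, ← ENNReal.ofReal_mul (by positivity),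
      ENNReal.ofReal_le_ofReal_iff (by positivity)] at h
    rw [Real.rpow_sub hx, div_le_div_iff₀ (by positivity) hc]
    linarith
  have hlim := tendsto_rpow_atTop (sub_pos.mpr hlt)
  obtain ⟨x, hx, hxpos, hxξ⟩ := ((hlim.eventually_gt_atTop (2 * M / c)).and
    ((Filter.eventually_gt_atTop 0).and (Filter.eventually_ge_atTop ξ₀))).exists
  exact (hbound x hxpos hxξ).not_gt hx
end

section
/- Let λ ∈ (0,2), c₀ > 0, and let ν be a nonnegative Borel measure on ℝ∖{0} satisfying ∫_{|z| ≤ ε} z² ν(dz) ≥ c₀ ε^{2−λ} for every ε ∈ (0,1]. Then for every ξ with |ξ| > 1: ∫_{ℝ∖{0}} (1 − cos(ξz)) ν(dz) ≥ (c₀/4) |ξ|^λ. -/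
open MeasureTheory

theorem sq_div_four_le_one_sub_cos {x : ℝ} (hx : |x| ≤ 1) : x ^ 2 / 4 ≤ 1 - Real.cos x := by
  have h := (abs_le.mp (Real.cos_bound hx)).2
  have h4 : |x| ^ 4 ≤ x ^ 2 := by
    rw [← sq_abs x]
    exact pow_le_pow_of_le_one (abs_nonneg x) hx (by norm_num)
  nlinarith [sq_nonneg x]

/-- Let `λ ∈ (0,2)`, `c₀ > 0` and let `ν` be a nonnegative Borel measure on `ℝ \ {0}`
with `∫_{|z| ≤ ε} z² ν(dz) ≥ c₀ ε^{2-λ}` for every `ε ∈ (0,1]`. Then for every `|ξ| > 1`,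
`∫ (1 - cos(ξz)) ν(dz) ≥ (c₀/4) |ξ|^λ`. -/
theorem lintegral_one_sub_cos_lower_bound
    (lam c₀ : ℝ) (hlam : lam ∈ Set.Ioo (0 : ℝ) 2) (hc₀ : 0 < c₀)
    (ν : Measure ℝ) (hν0 : ν {0} = 0)
    (hlow : ∀ ε ∈ Set.Ioc (0 : ℝ) 1,
      ENNReal.ofReal (c₀ * ε ^ (2 - lam))
        ≤ ∫⁻ z in {z : ℝ | |z| ≤ ε}, ENNReal.ofReal (z ^ 2) ∂ν) :
    ∀ ξ : ℝ, 1 < |ξ| →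
      ENNReal.ofReal (c₀ / 4 * |ξ| ^ lam)
        ≤ ∫⁻ z, ENNReal.ofReal (1 - Real.cos (ξ * z)) ∂ν := by
  intro ξ hξ
  have hpos : 0 < |ξ| := by linarith
  have hscale : c₀ / 4 * |ξ| ^ lam = ξ ^ 2 / 4 * (c₀ * |ξ|⁻¹ ^ (2 - lam)) := by
    rw [Real.inv_rpow hpos.le, ← Real.rpow_neg hpos.le, neg_sub, Real.rpow_sub hpos,
      Real.rpow_two, sq_abs]
    have : ξ ≠ 0 := abs_pos.mp hpos
    field_simp
  have hmeas : MeasurableSet {z : ℝ | |z| ≤ |ξ|⁻¹} :=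
    measurableSet_le measurable_id.abs measurable_const
  calc ENNReal.ofReal (c₀ / 4 * |ξ| ^ lam)
      = ENNReal.ofReal (ξ ^ 2 / 4) * ENNReal.ofReal (c₀ * |ξ|⁻¹ ^ (2 - lam)) := by
        rw [hscale, ENNReal.ofReal_mul (by positivity)]
    _ ≤ ENNReal.ofReal (ξ ^ 2 / 4) *
          ∫⁻ z in {z : ℝ | |z| ≤ |ξ|⁻¹}, ENNReal.ofReal (z ^ 2) ∂ν := by
        gcongr
        exact hlow _ ⟨inv_pos.mpr hpos, inv_le_one_of_one_le₀ hξ.le⟩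
    _ = ∫⁻ z in {z : ℝ | |z| ≤ |ξ|⁻¹}, ENNReal.ofReal (ξ ^ 2 / 4) * ENNReal.ofReal (z ^ 2) ∂ν :=
        (lintegral_const_mul _ (by fun_prop)).symm
    _ ≤ ∫⁻ z in {z : ℝ | |z| ≤ |ξ|⁻¹}, ENNReal.ofReal (1 - Real.cos (ξ * z)) ∂ν := by
        refine setLIntegral_mono' hmeas fun z hz => ?_
        rw [← ENNReal.ofReal_mul (by positivity)]
        have hξz : |ξ * z| ≤ 1 := by
          rw [abs_mul]
          exact (mul_le_mul_of_nonneg_left hz hpos.le).trans_eq (mul_inv_cancel₀ hpos.ne')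
        refine ENNReal.ofReal_le_ofReal (le_of_eq_of_le ?_ (sq_div_four_le_one_sub_cos hξz))
        ring
    _ ≤ ∫⁻ z, ENNReal.ofReal (1 - Real.cos (ξ * z)) ∂ν := setLIntegral_le_lintegral _ _
end
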